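/- Let n ≥ 1, let K ⊂ ℂⁿ be a compact set that is convex with respect to principal hypersurfaces, let U ⊆ ℂⁿ be an open set containing K, and let φ : U → ℝ be a smooth strictly plurisubharmonic function. Then there exists a smooth strictly plurisubharmonic function ψ : ℂⁿ → ℝ such that ψ − φ is pluriharmonic on some open neighborhood of K contained in U. -/

import Mathlib

open Complex

/-- The Levi quadratic form of a real-valued function on ℂⁿ:
`H_φ(x)(w) = D²φ(x)(w,w) + D²φ(x)(iw,iw)`. -/
noncomputable def leviForm {n : ℕ} (φ : EuclideanSpace ℂ (Fin n) → ℝ)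
    (x w : EuclideanSpace ℂ (Fin n)) : ℝ :=
  iteratedFDeriv ℝ 2 φ x ![w, w] +
    iteratedFDeriv ℝ 2 φ x ![Complex.I • w, Complex.I • w]

/-- A compact set `K ⊆ ℂⁿ` is convex with respect to principal hypersurfaces if every point
outside `K` is separated from `K` by the zero set of an entire function. -/
def PrincipalConvex {n : ℕ} (K : Set (EuclideanSpace ℂ (Fin n))) : Prop :=
  ∀ a ∉ K, ∃ f : EuclideanSpace ℂ (Fin n) → ℂ,
    Differentiable ℂ f ∧ f a = 0 ∧ ∀ z ∈ K, f z ≠ 0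

section EntireSmooth

variable {E : Type*} [NormedAddCommGroup E] [NormedSpace ℂ E]

theorem fderiv_apply_eq_deriv_line {f : E → ℂ} (hf : Differentiable ℂ f) (y v : E) :
    fderiv ℂ f y v = deriv (fun ζ : ℂ => f (y + ζ • v)) 0 := by
  have h1 : HasDerivAt (fun ζ : ℂ => y + ζ • v) v 0 := by
    simpa using ((hasDerivAt_id (0 : ℂ)).smul_const v).const_add y
  have h2 : HasFDerivAt f (fderiv ℂ f y) (y + (0 : ℂ) • v) := by
    simpa using (hf y).hasFDerivAt
  exact (h2.comp_hasDerivAt (0 : ℂ) h1).deriv.symm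

theorem differentiable_line {f : E → ℂ} (hf : Differentiable ℂ f) (y v : E) :
    Differentiable ℂ (fun ζ : ℂ => f (y + ζ • v)) := by
  fun_prop

theorem exists_circle_kernel_fderiv_apply {f : E → ℂ} (hf : Differentiable ℂ f) (v : E) :
    ∃ k : ℝ → ℂ, Continuous k ∧ ∀ y, fderiv ℂ f y v =
      ∫ θ in (0 : ℝ)..2 * Real.pi, k θ * f (y + circleMap 0 1 θ • v) := by
  refine ⟨fun θ => (2 * Real.pi * I : ℂ)⁻¹ *
    (deriv (circleMap 0 1) θ * ((circleMap 0 1 θ - 0) ^ 2)⁻¹), ?_, fun y => ?_⟩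
  · simp_rw [deriv_circleMap]
    refine continuous_const.mul (Continuous.mul (by fun_prop) (Continuous.inv₀ (by fun_prop) ?_))
    intro θ
    simp
  · rw [fderiv_apply_eq_deriv_line hf,
      ← two_pi_I_inv_smul_circleIntegral_sub_sq_inv_smul_of_differentiable isOpen_univ
        (Set.subset_univ (Metric.closedBall (0 : ℂ) 1))
        (differentiable_line hf y v).differentiableOn (Metric.mem_ball_self one_pos),
      circleIntegral, smul_eq_mul, ← intervalIntegral.integral_const_mul]
    refine intervalIntegral.integral_congr fun θ _ => ?_
    simp only [smul_eq_mul]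
    ring

theorem norm_fderiv_le_of_norm_le {f : E → ℂ} (hf : Differentiable ℂ f) {y : E} {M : ℝ}
    (hM : ∀ z ∈ Metric.closedBall y 1, ‖f z‖ ≤ M) : ‖fderiv ℂ f y‖ ≤ M := by
  have hM0 : 0 ≤ M := (norm_nonneg _).trans (hM y (by simp))
  refine ContinuousLinearMap.opNorm_le_of_unit_norm hM0 fun v hv => ?_
  rw [fderiv_apply_eq_deriv_line hf]
  have := norm_deriv_le_of_forall_mem_sphere_norm_le (c := 0) (C := M) one_pos
    (differentiable_line hf y v).diffContOnCl (fun ζ hζ => hM _ (by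
      have : ‖ζ‖ = 1 := by simpa using hζ
      simp [norm_smul, this, hv]))
  simpa using this

variable [FiniteDimensional ℂ E]

theorem differentiable_fderiv_apply {f : E → ℂ} (hf : Differentiable ℂ f) (v : E) :
    Differentiable ℂ fun y => fderiv ℂ f y v := by
  borelize E
  have : ProperSpace E := FiniteDimensional.proper ℂ E
  obtain ⟨k, hk, hfk⟩ := exists_circle_kernel_fderiv_apply hf v
  intro x
  obtain ⟨M, hM⟩ := (isCompact_closedBall x (‖v‖ + 2)).exists_bound_of_continuousOn
    hf.continuous.continuousOn
  have hbd : ∀ y ∈ Metric.ball x 1, ∀ θ : ℝ, ‖fderiv ℂ f (y + circleMap 0 1 θ • v)‖ ≤ M := by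
    intro y hy θ
    refine norm_fderiv_le_of_norm_le hf fun z hz => hM z ?_
    rw [Metric.mem_ball, dist_eq_norm] at hy
    rw [Metric.mem_closedBall, dist_eq_norm] at hz ⊢
    have hc : ‖circleMap 0 1 θ • v‖ = ‖v‖ := by simp [norm_smul]
    calc ‖z - x‖ = ‖(z - (y + circleMap 0 1 θ • v)) + (y - x) + circleMap 0 1 θ • v‖ := by
          congr 1; abel
      _ ≤ ‖z - (y + circleMap 0 1 θ • v)‖ + ‖y - x‖ + ‖circleMap 0 1 θ • v‖ := norm_add₃_le
      _ ≤ ‖v‖ + 2 := by linarith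
  have hcont : ∀ y, Continuous fun θ : ℝ => k θ * f (y + circleMap 0 1 θ • v) := fun y =>
    hk.mul (hf.continuous.comp (by fun_prop))
  have key := intervalIntegral.hasFDerivAt_integral_of_dominated_of_fderiv_le
    (𝕜 := ℂ) (μ := MeasureTheory.volume) (a := 0) (b := 2 * Real.pi) (x₀ := x)
    (F := fun y θ => k θ * f (y + circleMap 0 1 θ • v))
    (F' := fun y θ => k θ • fderiv ℂ f (y + circleMap 0 1 θ • v))
    (bound := fun θ => ‖k θ‖ * M) (Metric.ball_mem_nhds x one_pos)
    (.of_forall fun y => (hcont y).aestronglyMeasurable)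
    ((hcont x).intervalIntegrable _ _)
    (hk.aestronglyMeasurable.smul ((measurable_fderiv ℂ f).comp
      (Continuous.measurable (by fun_prop))).aestronglyMeasurable)
    (.of_forall fun θ _ y hy => by
      rw [norm_smul]
      exact mul_le_mul_of_nonneg_left (hbd y hy θ) (norm_nonneg _))
    ((hk.norm.mul continuous_const).intervalIntegrable _ _)
    (.of_forall fun θ _ y _ => by
      have h1 : HasFDerivAt (fun y => f (y + circleMap 0 1 θ • v))
          (fderiv ℂ f (y + circleMap 0 1 θ • v)) y :=
        (hasFDerivAt_comp_add_right _).2 (hf _).hasFDerivAt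
      exact h1.const_mul (k θ))
  simp only [hfk]
  exact key.differentiableAt

theorem Differentiable.contDiff_of_finiteDimensional {f : E → ℂ} (hf : Differentiable ℂ f) :
    ContDiff ℂ (⊤ : ℕ∞) f := by
  rw [contDiff_infty]
  intro m
  induction m generalizing f with
  | zero => exact contDiff_zero.2 hf.continuous
  | succ m ih =>
    push_cast
    exact contDiff_succ_iff_fderiv_apply.2
      ⟨hf, by simp, fun v => ih (differentiable_fderiv_apply hf v)⟩

end EntireSmooth

section LeviForm

variable {n : ℕ} {φ ψ : EuclideanSpace ℂ (Fin n) → ℝ} {x w : EuclideanSpace ℂ (Fin n)}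

theorem leviForm_eq_fderiv_fderiv (φ : EuclideanSpace ℂ (Fin n) → ℝ)
    (x w : EuclideanSpace ℂ (Fin n)) :
    leviForm φ x w = fderiv ℝ (fderiv ℝ φ) x w w + fderiv ℝ (fderiv ℝ φ) x (I • w) (I • w) := by
  simp [leviForm, iteratedFDeriv_two_apply]

theorem leviForm_congr_of_eventuallyEq (h : φ =ᶠ[nhds x] ψ) (w : EuclideanSpace ℂ (Fin n)) :
    leviForm φ x w = leviForm ψ x w := by
  simp only [leviForm, (h.iteratedFDeriv ℝ 2).eq_of_nhds]

theorem leviForm_zero (x w : EuclideanSpace ℂ (Fin n)) :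
    leviForm (fun _ => (0 : ℝ)) x w = 0 := by
  simp [leviForm_eq_fderiv_fderiv]

theorem leviForm_add (hφ : ContDiff ℝ (⊤ : ℕ∞) φ) (hψ : ContDiff ℝ (⊤ : ℕ∞) ψ)
    (x w : EuclideanSpace ℂ (Fin n)) :
    leviForm (fun z => φ z + ψ z) x w = leviForm φ x w + leviForm ψ x w := by
  have h := iteratedFDeriv_add_apply (𝕜 := ℝ) (i := 2) (x := x)
    (contDiff_infty.1 hφ 2).contDiffAt (contDiff_infty.1 hψ 2).contDiffAt
  change iteratedFDeriv ℝ 2 (fun z => φ z + ψ z) x = _ at h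
  simp only [leviForm, h, add_apply]
  ring

theorem leviForm_sum {ι : Type*} (s : Finset ι) {u : ι → EuclideanSpace ℂ (Fin n) → ℝ}
    (hu : ∀ i ∈ s, ContDiff ℝ (⊤ : ℕ∞) (u i)) (x w : EuclideanSpace ℂ (Fin n)) :
    leviForm (fun z => ∑ i ∈ s, u i z) x w = ∑ i ∈ s, leviForm (u i) x w := by
  classical
  induction s using Finset.induction_on with
  | empty => simpa using leviForm_zero x w
  | insert a s ha ih =>
    simp only [Finset.sum_insert ha]
    rw [leviForm_add (hu a (by simp)) (ContDiff.sum fun i hi => hu i (by simp [hi])),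
      ih fun i hi => hu i (by simp [hi])]

theorem leviForm_real_smul (φ : EuclideanSpace ℂ (Fin n) → ℝ) (x w : EuclideanSpace ℂ (Fin n))
    (c : ℝ) : leviForm φ x (c • w) = c ^ 2 * leviForm φ x w := by
  simp only [leviForm_eq_fderiv_fderiv, smul_comm I c w, map_smul, smul_apply, smul_eq_mul]
  ring

theorem continuous_leviForm (hφ : ContDiff ℝ (⊤ : ℕ∞) φ) :
    Continuous fun p : EuclideanSpace ℂ (Fin n) × EuclideanSpace ℂ (Fin n) =>
      leviForm φ p.1 p.2 := by
  have h1 : ContDiff ℝ (⊤ : ℕ∞) (fderiv ℝ φ) := (contDiff_infty_iff_fderiv.1 hφ).2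
  have h2 : Continuous (fderiv ℝ (fderiv ℝ φ)) := h1.continuous_fderiv (by simp)
  simp only [leviForm_eq_fderiv_fderiv]
  fun_prop

theorem leviForm_eq_fderiv_apply (hφ : ContDiff ℝ (⊤ : ℕ∞) φ) (x w : EuclideanSpace ℂ (Fin n)) :
    leviForm φ x w = fderiv ℝ (fun y => fderiv ℝ φ y w) x w +
      fderiv ℝ (fun y => fderiv ℝ φ y (I • w)) x (I • w) := by
  have h1 : ContDiff ℝ (⊤ : ℕ∞) (fderiv ℝ φ) := (contDiff_infty_iff_fderiv.1 hφ).2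
  have h2 : DifferentiableAt ℝ (fderiv ℝ φ) x := h1.differentiable (by simp) x
  rw [leviForm_eq_fderiv_fderiv, fderiv_clm_apply h2 (by fun_prop),
    fderiv_clm_apply h2 (by fun_prop)]
  simp

theorem fderiv_real_comp {F : ℝ → ℝ} (hF : ContDiff ℝ (⊤ : ℕ∞) F)
    (hφ : ContDiff ℝ (⊤ : ℕ∞) φ) (y v : EuclideanSpace ℂ (Fin n)) :
    fderiv ℝ (fun z => F (φ z)) y v = deriv F (φ y) * fderiv ℝ φ y v := by
  have h1 := (hF.differentiable (by simp) (φ y)).hasDerivAt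
  have h2 := (hφ.differentiable (by simp) y).hasFDerivAt
  have h3 := (h1.comp_hasFDerivAt y h2).fderiv
  change fderiv ℝ (fun z => F (φ z)) y = _ at h3
  rw [h3]
  simp

theorem leviForm_comp {F : ℝ → ℝ} (hF : ContDiff ℝ (⊤ : ℕ∞) F)
    (hφ : ContDiff ℝ (⊤ : ℕ∞) φ) (x w : EuclideanSpace ℂ (Fin n)) :
    leviForm (fun z => F (φ z)) x w = deriv F (φ x) * leviForm φ x w +
      deriv (deriv F) (φ x) * (fderiv ℝ φ x w ^ 2 + fderiv ℝ φ x (I • w) ^ 2) := by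
  have hF' : ContDiff ℝ (⊤ : ℕ∞) (deriv F) := (contDiff_infty_iff_deriv.1 hF).2
  have h1 : ContDiff ℝ (⊤ : ℕ∞) (fderiv ℝ φ) := (contDiff_infty_iff_fderiv.1 hφ).2
  have h2 : Differentiable ℝ (fderiv ℝ φ) := h1.differentiable (by simp)
  have key : ∀ v, fderiv ℝ (fun y => fderiv ℝ (fun z => F (φ z)) y v) x v =
      deriv F (φ x) * fderiv ℝ (fun y => fderiv ℝ φ y v) x v +
        deriv (deriv F) (φ x) * fderiv ℝ φ x v ^ 2 := by
    intro v
    simp only [fderiv_real_comp hF hφ]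
    have h3 : DifferentiableAt ℝ (fun y => deriv F (φ y)) x :=
      (hF'.comp hφ).differentiable (by simp) x
    rw [fderiv_fun_mul h3 ((h2 x).clm_apply (by fun_prop))]
    simp only [add_apply, smul_apply, smul_eq_mul, fderiv_real_comp hF' hφ]
    ring
  have hFφ : ContDiff ℝ (⊤ : ℕ∞) fun z => F (φ z) := hF.comp hφ
  rw [leviForm_eq_fderiv_apply hFφ, leviForm_eq_fderiv_apply hφ, key, key]
  ring

theorem leviForm_const_mul (hφ : ContDiff ℝ (⊤ : ℕ∞) φ) (c : ℝ)
    (x w : EuclideanSpace ℂ (Fin n)) :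
    leviForm (fun z => c * φ z) x w = c * leviForm φ x w := by
  have h : deriv (fun s : ℝ => c * s) = fun _ => c := by ext s; simp
  rw [leviForm_comp (F := fun s => c * s) (by fun_prop) hφ, h]
  simp

theorem fderiv_re {g : EuclideanSpace ℂ (Fin n) → ℂ} (hg : Differentiable ℂ g)
    (y v : EuclideanSpace ℂ (Fin n)) :
    fderiv ℝ (fun z => (g z).re) y v = (fderiv ℂ g y v).re := by
  have h := (reCLM.hasFDerivAt.comp y ((hg y).hasFDerivAt.restrictScalars ℝ)).fderiv
  change fderiv ℝ (fun z => (g z).re) y = _ at h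
  rw [h]
  simp

theorem contDiff_re {g : EuclideanSpace ℂ (Fin n) → ℂ} (hg : Differentiable ℂ g) :
    ContDiff ℝ (⊤ : ℕ∞) fun z => (g z).re :=
  reCLM.contDiff.comp (hg.contDiff_of_finiteDimensional.restrict_scalars ℝ)

theorem leviForm_re {g : EuclideanSpace ℂ (Fin n) → ℂ} (hg : Differentiable ℂ g)
    (x w : EuclideanSpace ℂ (Fin n)) : leviForm (fun z => (g z).re) x w = 0 := by
  rw [leviForm_eq_fderiv_apply (contDiff_re hg)]
  simp only [fderiv_re hg, fderiv_re (differentiable_fderiv_apply hg _)]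
  simp only [map_smul]
  rw [fderiv_fun_const_smul (differentiable_fderiv_apply hg w x)]
  simp

theorem leviForm_sq_re {g : EuclideanSpace ℂ (Fin n) → ℂ} (hg : Differentiable ℂ g)
    (x w : EuclideanSpace ℂ (Fin n)) :
    leviForm (fun z => (g z).re ^ 2) x w = 2 * normSq (fderiv ℂ g x w) := by
  have h2 : deriv (fun s : ℝ => s ^ 2) = fun s => 2 * s := by ext s; simp
  rw [leviForm_comp (F := fun s => s ^ 2) (by fun_prop) (contDiff_re hg), leviForm_re hg, h2,
    fderiv_re hg, fderiv_re hg, map_smul, normSq_apply, deriv_const_mul_id']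
  simp
  ring

theorem normSq_eq_sq_re_add {g : EuclideanSpace ℂ (Fin n) → ℂ} :
    (fun z => normSq (g z)) = fun z => (g z).re ^ 2 + (-I * g z).re ^ 2 := by
  ext z
  simp [normSq_apply, pow_two]

theorem contDiff_normSq {g : EuclideanSpace ℂ (Fin n) → ℂ} (hg : Differentiable ℂ g) :
    ContDiff ℝ (⊤ : ℕ∞) fun z => normSq (g z) := by
  rw [normSq_eq_sq_re_add]
  exact ((contDiff_re hg).pow 2).add ((contDiff_re (hg.const_mul (-I))).pow 2)

theorem leviForm_normSq {g : EuclideanSpace ℂ (Fin n) → ℂ} (hg : Differentiable ℂ g)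
    (x w : EuclideanSpace ℂ (Fin n)) :
    leviForm (fun z => normSq (g z)) x w = 4 * normSq (fderiv ℂ g x w) := by
  have hg' := hg.const_mul (-I)
  rw [normSq_eq_sq_re_add, leviForm_add ((contDiff_re hg).pow 2) ((contDiff_re hg').pow 2),
    leviForm_sq_re hg, leviForm_sq_re hg', fderiv_const_mul (hg x)]
  simp
  ring

theorem fderiv_normSq {g : EuclideanSpace ℂ (Fin n) → ℂ} (hg : Differentiable ℂ g)
    (x v : EuclideanSpace ℂ (Fin n)) :
    fderiv ℝ (fun z => normSq (g z)) x v =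
      2 * ((g x).re * (fderiv ℂ g x v).re + (g x).im * (fderiv ℂ g x v).im) := by
  have hg' := hg.const_mul (-I)
  have d := (contDiff_re hg).differentiable (by simp) x
  have d' := (contDiff_re hg').differentiable (by simp) x
  rw [normSq_eq_sq_re_add, fderiv_fun_add (d.fun_pow 2) (d'.fun_pow 2), fderiv_fun_pow 2 d,
    fderiv_fun_pow 2 d']
  simp only [add_apply, smul_apply, fderiv_re hg, fderiv_re hg', fderiv_const_mul (hg x)]
  simp
  ring

theorem leviForm_comp_normSq {F : ℝ → ℝ} (hF : ContDiff ℝ (⊤ : ℕ∞) F)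
    {g : EuclideanSpace ℂ (Fin n) → ℂ} (hg : Differentiable ℂ g)
    (x w : EuclideanSpace ℂ (Fin n)) :
    leviForm (fun z => F (normSq (g z))) x w =
      4 * (deriv F (normSq (g x)) + normSq (g x) * deriv (deriv F) (normSq (g x))) *
        normSq (fderiv ℂ g x w) := by
  rw [leviForm_comp hF (contDiff_normSq hg), leviForm_normSq hg, fderiv_normSq hg,
    fderiv_normSq hg, map_smul]
  simp [normSq_apply]
  ring

theorem leviForm_norm_sq (x w : EuclideanSpace ℂ (Fin n)) :
    leviForm (fun z => ‖z‖ ^ 2) x w = 4 * ‖w‖ ^ 2 := by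
  have hp : ∀ i : Fin n, Differentiable ℂ fun z : EuclideanSpace ℂ (Fin n) => z i :=
    fun i => by fun_prop
  have hd : ∀ i : Fin n, fderiv ℂ (fun z : EuclideanSpace ℂ (Fin n) => z i) x w = w i :=
    fun i => by
      have := (EuclideanSpace.proj i : EuclideanSpace ℂ (Fin n) →L[ℂ] ℂ).fderiv (x := x)
      change fderiv ℂ (fun z : EuclideanSpace ℂ (Fin n) => z i) x = _ at this
      rw [this]
      rfl
  simp only [EuclideanSpace.norm_sq_eq, ← normSq_eq_norm_sq]
  rw [leviForm_sum _ fun i _ => contDiff_normSq (hp i)]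
  simp only [leviForm_normSq (hp _), hd, Finset.mul_sum]

end LeviForm

section Profiles

theorem exists_contDiff_deriv_eq {k : ℝ → ℝ} (hk : ContDiff ℝ (⊤ : ℕ∞) k) :
    ∃ F : ℝ → ℝ, ContDiff ℝ (⊤ : ℕ∞) F ∧ deriv F = k := by
  have hd : ∀ s, HasDerivAt (fun s => ∫ t in (0 : ℝ)..s, k t) (k s) s := fun s =>
    intervalIntegral.integral_hasDerivAt_right (hk.continuous.intervalIntegrable _ _)
      hk.continuous.aestronglyMeasurable.stronglyMeasurableAtFilter hk.continuous.continuousAt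
  have he : deriv (fun s => ∫ t in (0 : ℝ)..s, k t) = k := funext fun s => (hd s).deriv
  exact ⟨_, contDiff_infty_iff_deriv.2 ⟨fun s => (hd s).differentiableAt, by rwa [he]⟩, he⟩

theorem deriv_eq_zero_of_nonneg_of_eq_zero {p : ℝ → ℝ} (hp : ∀ y, 0 ≤ p y) {y : ℝ}
    (hy : p y = 0) : deriv p y = 0 :=
  IsLocalMin.deriv_eq_zero (.of_forall fun z => by simpa [hy] using hp z)

/-- A smooth modification of the logarithm on `[0, ∞)`: the radial Laplacian of `F`, which vanishes
for the logarithm, is nonnegative, vanishes for `1 ≤ s`, and is positive at the origin. -/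
theorem exists_log_profile : ∃ F : ℝ → ℝ, ContDiff ℝ (⊤ : ℕ∞) F ∧
    (∀ s, 0 ≤ s → 0 ≤ deriv F s + s * deriv (deriv F) s) ∧
    (∀ s, 1 ≤ s → deriv F s + s * deriv (deriv F) s = 0) ∧ 0 < deriv F 0 := by
  set p : ℝ → ℝ := fun y => expNegInvGlue y * Real.exp y with hp
  have p_smooth : ContDiff ℝ (⊤ : ℕ∞) p := expNegInvGlue.contDiff.mul Real.contDiff_exp
  have p_nonneg : ∀ y, 0 ≤ p y := fun y =>
    mul_nonneg (expNegInvGlue.nonneg y) (Real.exp_nonneg y)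
  have p_zero : ∀ y ≤ 0, p y = 0 := fun y hy => by simp [hp, expNegInvGlue.zero_of_nonpos hy]
  have p_mono : Monotone p := fun y z hyz =>
    mul_le_mul (expNegInvGlue.monotone hyz) (Real.exp_le_exp.2 hyz) (Real.exp_nonneg y)
      (expNegInvGlue.nonneg z)
  have p_gt : ∀ y, 1 ≤ y → y ≤ p y := fun y hy => by
    have h0 : p y = Real.exp (-y⁻¹ + y) := by
      simp [hp, expNegInvGlue, not_le.2 (one_pos.trans_le hy), Real.exp_add]
    have h1 := inv_le_one_of_one_le₀ hy
    have h2 := Real.add_one_le_exp (-y⁻¹ + y)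
    linarith
  set m : ℝ → ℝ := fun s => s + p (1 - s) with hm
  have m_smooth : ContDiff ℝ (⊤ : ℕ∞) m := by fun_prop
  have m_pos : ∀ s, 0 < m s := fun s => by
    rcases le_or_gt s 0 with hs | hs
    · have := p_gt (1 - s) (by linarith)
      simp only [hm]
      linarith
    · exact add_pos_of_pos_of_nonneg hs (p_nonneg _)
  have m_deriv : ∀ s, HasDerivAt m (1 - deriv p (1 - s)) s := fun s => by
    have h1 := (p_smooth.differentiable (by simp) (1 - s)).hasDerivAt
    have h2 := (hasDerivAt_id s).add (h1.comp_const_sub 1 s)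
    exact h2.congr_deriv (by ring)
  obtain ⟨F, hF, hF'⟩ := exists_contDiff_deriv_eq (m_smooth.inv fun s => (m_pos s).ne')
  have key : ∀ s, deriv F s + s * deriv (deriv F) s =
      (p (1 - s) + s * deriv p (1 - s)) / m s ^ 2 := fun s => by
    have h : deriv (deriv F) s = -(1 - deriv p (1 - s)) / m s ^ 2 := by
      rw [hF']
      exact ((m_deriv s).fun_inv (m_pos s).ne').deriv
    have := (m_pos s).ne'
    rw [h, hF', Pi.inv_apply]
    field_simp
    simp only [hm]
    ring
  refine ⟨F, hF, fun s hs => ?_, fun s hs => ?_, ?_⟩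
  · rw [key]
    have := p_mono.deriv_nonneg (x := 1 - s)
    have := p_nonneg (1 - s)
    positivity
  · have h0 := p_zero (1 - s) (by linarith)
    rw [key, h0, deriv_eq_zero_of_nonneg_of_eq_zero p_nonneg h0]
    simp
  · rw [hF']
    exact inv_pos.2 (m_pos 0)

/-- A smooth convex function that is flat on `(-∞, 0]` and strictly increasing on `[0, ∞)`. -/
theorem exists_convex_profile : ∃ F : ℝ → ℝ, ContDiff ℝ (⊤ : ℕ∞) F ∧
    (∀ s, 0 ≤ deriv F s) ∧ (∀ s, 0 ≤ deriv (deriv F) s) ∧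
    (∀ s ≤ 0, deriv F s = 0 ∧ deriv (deriv F) s = 0) ∧ ∀ s, 0 < s → 0 < deriv F s := by
  obtain ⟨F, hF, hF'⟩ := exists_contDiff_deriv_eq (k := expNegInvGlue) expNegInvGlue.contDiff
  refine ⟨F, hF, ?_⟩
  rw [hF']
  refine ⟨expNegInvGlue.nonneg, fun s => expNegInvGlue.monotone.deriv_nonneg, fun s hs => ?_,
    fun s => expNegInvGlue.pos_of_pos⟩
  have h0 := expNegInvGlue.zero_of_nonpos hs
  exact ⟨h0, deriv_eq_zero_of_nonneg_of_eq_zero expNegInvGlue.nonneg h0⟩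

end Profiles

/-- Smooth plurisubharmonic functions whose Levi form vanishes in a neighborhood of `K`. -/
structure IsPshFlatNear {n : ℕ} (K : Set (EuclideanSpace ℂ (Fin n)))
    (u : EuclideanSpace ℂ (Fin n) → ℝ) : Prop where
  contDiff : ContDiff ℝ (⊤ : ℕ∞) u
  leviForm_nonneg : ∀ x w, 0 ≤ leviForm u x w
  leviForm_eq_zero : ∀ᶠ x in nhdsSet K, ∀ w, leviForm u x w = 0

namespace IsPshFlatNear

variable {n : ℕ} {K : Set (EuclideanSpace ℂ (Fin n))} {u v : EuclideanSpace ℂ (Fin n) → ℝ}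

theorem zero : IsPshFlatNear K fun _ => 0 :=
  ⟨contDiff_const, fun x w => (leviForm_zero x w).ge, .of_forall leviForm_zero⟩

theorem add (hu : IsPshFlatNear K u) (hv : IsPshFlatNear K v) :
    IsPshFlatNear K fun z => u z + v z where
  contDiff := hu.contDiff.add hv.contDiff
  leviForm_nonneg x w := by
    rw [leviForm_add hu.contDiff hv.contDiff]
    exact add_nonneg (hu.leviForm_nonneg x w) (hv.leviForm_nonneg x w)
  leviForm_eq_zero := by
    filter_upwards [hu.leviForm_eq_zero, hv.leviForm_eq_zero] with x h1 h2 w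
    rw [leviForm_add hu.contDiff hv.contDiff, h1, h2, add_zero]

theorem const_mul (hu : IsPshFlatNear K u) {c : ℝ} (hc : 0 ≤ c) :
    IsPshFlatNear K fun z => c * u z where
  contDiff := contDiff_const.mul hu.contDiff
  leviForm_nonneg x w := by
    rw [leviForm_const_mul hu.contDiff]
    exact mul_nonneg hc (hu.leviForm_nonneg x w)
  leviForm_eq_zero := by
    filter_upwards [hu.leviForm_eq_zero] with x h w
    rw [leviForm_const_mul hu.contDiff, h, mul_zero]

end IsPshFlatNear

section Separation

variable {n : ℕ} {K : Set (EuclideanSpace ℂ (Fin n))}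

theorem exists_isPshFlatNear_pos_off_closedBall {R : ℝ} (hR : 0 ≤ R)
    (hKR : K ⊆ Metric.ball 0 R) : ∃ u : EuclideanSpace ℂ (Fin n) → ℝ, IsPshFlatNear K u ∧
      ∀ x w, R < ‖x‖ → w ≠ 0 → 0 < leviForm u x w := by
  obtain ⟨F, hF, h1, h2, h3, h4⟩ := exists_convex_profile
  have hρ : ContDiff ℝ (⊤ : ℕ∞) fun z : EuclideanSpace ℂ (Fin n) => ‖z‖ ^ 2 + -R ^ 2 :=
    (contDiff_norm_sq ℝ).add contDiff_const
  have hl : ∀ x w : EuclideanSpace ℂ (Fin n),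
      leviForm (fun z => ‖z‖ ^ 2 + -R ^ 2) x w = 4 * ‖w‖ ^ 2 := fun x w => by
    rw [leviForm_add (contDiff_norm_sq ℝ) contDiff_const, leviForm_norm_sq]
    simp [leviForm_eq_fderiv_fderiv (fun _ => -R ^ 2)]
  refine ⟨fun z => F (‖z‖ ^ 2 + -R ^ 2), ⟨hF.comp hρ, fun x w => ?_, ?_⟩, fun x w hx hw => ?_⟩
  · rw [leviForm_comp hF hρ, hl]
    have := h1 (‖x‖ ^ 2 + -R ^ 2)
    have := h2 (‖x‖ ^ 2 + -R ^ 2)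
    positivity
  · filter_upwards [Metric.isOpen_ball.mem_nhdsSet.2 hKR] with x hx w
    rw [mem_ball_zero_iff] at hx
    obtain ⟨h5, h6⟩ := h3 (‖x‖ ^ 2 + -R ^ 2) (by nlinarith [norm_nonneg x])
    rw [leviForm_comp hF hρ, h5, h6]
    simp
  · rw [leviForm_comp hF hρ, hl]
    have := h4 (‖x‖ ^ 2 + -R ^ 2) (by nlinarith [norm_nonneg x])
    have := h2 (‖x‖ ^ 2 + -R ^ 2)
    have := norm_pos_iff.2 hw
    positivity

theorem exists_entire_separating_transverse (hKc : IsCompact K) (hK : PrincipalConvex K)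
    {a w : EuclideanSpace ℂ (Fin n)} (ha : a ∉ K) (hw : w ≠ 0) :
    ∃ g : EuclideanSpace ℂ (Fin n) → ℂ, Differentiable ℂ g ∧ g a = 0 ∧ fderiv ℂ g a w ≠ 0 ∧
      ∀ z ∈ K, 1 < ‖g z‖ := by
  obtain ⟨h, hd, hha, hhw, hhK⟩ : ∃ h : EuclideanSpace ℂ (Fin n) → ℂ, Differentiable ℂ h ∧
      h a = 0 ∧ fderiv ℂ h a w ≠ 0 ∧ ∀ z ∈ K, 0 < ‖h z‖ := by
    obtain ⟨f, hf, hfa, hfK⟩ := hK a ha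
    by_cases hfw : fderiv ℂ f a w = 0
    · obtain ⟨δ, hδ, hδK⟩ := hKc.exists_forall_le' (a := (0 : ℝ)) hf.continuous.norm.continuousOn
        fun z hz => norm_pos_iff.2 (hfK z hz)
      let l : EuclideanSpace ℂ (Fin n) →L[ℂ] ℂ := innerSL ℂ w
      have hl : ∀ z, HasFDerivAt (fun z => l (z - a)) l z := fun z =>
        l.hasFDerivAt.comp z ((hasFDerivAt_id z).sub_const a)
      have hld : Differentiable ℂ fun z => l (z - a) := fun z => (hl z).differentiableAt
      obtain ⟨C, hC⟩ := hKc.exists_bound_of_continuousOn hld.continuous.continuousOn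
      obtain ⟨ε, hε, hεC⟩ := exists_pos_mul_lt hδ (max C 0)
      refine ⟨fun z => f z + (ε : ℂ) * l (z - a), hf.add (hld.const_mul _), by simp [hfa], ?_,
        fun z hz => ?_⟩
      · rw [fderiv_fun_add (hf a) ((hld a).const_mul _), fderiv_const_mul (hld a), (hl a).fderiv]
        simp [hfw, l, hε.ne', hw]
      · have h1 := hδK z hz
        have h2 : ‖(ε : ℂ) * l (z - a)‖ < δ := by
          rw [norm_mul, norm_real, Real.norm_of_nonneg hε.le, mul_comm]
          exact (mul_le_mul_of_nonneg_right ((hC z hz).trans (le_max_left C 0)) hε.le).trans_lt hεC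
        have h3 := norm_sub_le_norm_add (f z) ((ε : ℂ) * l (z - a))
        linarith
    · exact ⟨f, hf, hfa, hfw, fun z hz => norm_pos_iff.2 (hfK z hz)⟩
  obtain ⟨δ, hδ, hδK⟩ := hKc.exists_forall_le' (a := (0 : ℝ)) hd.continuous.norm.continuousOn hhK
  refine ⟨fun z => ((2 / δ : ℝ) : ℂ) * h z, hd.const_mul _, by simp [hha], ?_, fun z hz => ?_⟩
  · rw [fderiv_const_mul (hd a)]
    simp [hhw, hδ.ne']
  · rw [norm_mul, norm_real, Real.norm_of_nonneg (by positivity), div_mul_eq_mul_div,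
      lt_div_iff₀ hδ]
    linarith [hδK z hz]

theorem exists_isPshFlatNear_pos_at (hKc : IsCompact K) (hK : PrincipalConvex K)
    {a w : EuclideanSpace ℂ (Fin n)} (ha : a ∉ K) (hw : w ≠ 0) :
    ∃ u, IsPshFlatNear K u ∧ 0 < leviForm u a w := by
  obtain ⟨g, hg, hga, hgw, hgK⟩ := exists_entire_separating_transverse hKc hK ha hw
  obtain ⟨F, hF, h1, h2, h3⟩ := exists_log_profile
  refine ⟨fun z => F (normSq (g z)), ⟨hF.comp (contDiff_normSq hg), fun x v => ?_, ?_⟩, ?_⟩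
  · rw [leviForm_comp_normSq hF hg]
    have := h1 _ (normSq_nonneg (g x))
    have := normSq_nonneg (fderiv ℂ g x v)
    positivity
  · have ho : IsOpen {z | 1 < ‖g z‖} := isOpen_lt continuous_const hg.continuous.norm
    filter_upwards [ho.mem_nhdsSet.2 hgK] with x hx v
    have hx' : 1 < ‖g x‖ := hx
    rw [leviForm_comp_normSq hF hg, h2 _ (by rw [normSq_eq_norm_sq]; nlinarith)]
    simp
  · rw [leviForm_comp_normSq hF hg, hga]
    have := normSq_pos.2 hgw
    simp only [map_zero, zero_mul, add_zero]
    positivity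

theorem exists_isPshFlatNear_add_pos (hKc : IsCompact K) (hK : PrincipalConvex K)
    {θ : EuclideanSpace ℂ (Fin n) → ℝ} (hθ : ContDiff ℝ (⊤ : ℕ∞) θ)
    {S : Set (EuclideanSpace ℂ (Fin n) × EuclideanSpace ℂ (Fin n))} (hS : IsCompact S)
    (hSK : ∀ p ∈ S, p.1 ∉ K ∧ p.2 ≠ 0) :
    ∃ u, IsPshFlatNear K u ∧ ∀ p ∈ S, 0 < leviForm θ p.1 p.2 + leviForm u p.1 p.2 := by
  refine hS.induction_on
    (p := fun T => ∃ u, IsPshFlatNear K u ∧ ∀ p ∈ T, 0 < leviForm θ p.1 p.2 + leviForm u p.1 p.2)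
    ⟨_, .zero, by simp⟩ (fun s t hst ⟨u, hu, h⟩ => ⟨u, hu, fun p hp => h p (hst hp)⟩)
    (fun s t ⟨u, hu, h⟩ ⟨v, hv, h'⟩ => ⟨_, hu.add hv, fun p hp => ?_⟩) fun p hp => ?_
  · rw [leviForm_add hu.contDiff hv.contDiff]
    rcases hp with hp | hp
    · linarith [h p hp, hv.leviForm_nonneg p.1 p.2]
    · linarith [h' p hp, hu.leviForm_nonneg p.1 p.2]
  · obtain ⟨hpK, hp0⟩ := hSK p hp
    obtain ⟨u, hu, hup⟩ := exists_isPshFlatNear_pos_at hKc hK hpK hp0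
    obtain ⟨c, hc⟩ := exists_nat_gt (-leviForm θ p.1 p.2 / leviForm u p.1 p.2)
    have hcu := hu.const_mul (Nat.cast_nonneg (α := ℝ) c)
    have hpos : 0 < leviForm θ p.1 p.2 + leviForm (fun z => c * u z) p.1 p.2 := by
      rw [leviForm_const_mul hu.contDiff]
      linarith [(div_lt_iff₀ hup).1 hc]
    exact ⟨_, mem_nhdsWithin_of_mem_nhds (((continuous_leviForm hθ).add
      (continuous_leviForm hcu.contDiff)).continuousAt.eventually (lt_mem_nhds hpos)), _, hcu,
      fun q hq => hq⟩

end Separation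

theorem exists_cutoff_mul_contDiff {E : Type*} [NormedAddCommGroup E] [NormedSpace ℝ E]
    [FiniteDimensional ℝ E] {K U : Set E} (hKc : IsCompact K) (hU : IsOpen U) (hKU : K ⊆ U)
    {φ : E → ℝ} (hφ : ContDiffOn ℝ (⊤ : ℕ∞) φ U) :
    ∃ (θ : E → ℝ) (V : Set E), ContDiff ℝ (⊤ : ℕ∞) θ ∧ HasCompactSupport θ ∧ IsOpen V ∧ K ⊆ V ∧
      V ⊆ U ∧ Set.EqOn θ φ V := by
  obtain ⟨L, hL, hKL, hLU⟩ := exists_compact_between hKc hU hKU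
  obtain ⟨χ, hχ1, hχ0, -⟩ := exists_contMDiffMap_one_nhds_of_subset_interior
    (modelWithCornersSelf ℝ E) (n := (⊤ : ℕ∞)) hKc.isClosed hKL
  have hχ : ContDiff ℝ (⊤ : ℕ∞) χ := χ.contMDiff.contDiff
  obtain ⟨W, hW, hKW, hW1⟩ := mem_nhdsSet_iff_exists.1 hχ1
  have hsupp : ∀ x ∉ L, χ x * φ x = 0 := fun x hx => by rw [hχ0 x hx, zero_mul]
  refine ⟨fun x => χ x * φ x, W ∩ U, contDiff_iff_contDiffAt.2 fun x => ?_,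
    HasCompactSupport.intro hL hsupp, hW.inter hU, Set.subset_inter hKW hKU,
    Set.inter_subset_right, fun x hx => ?_⟩
  · by_cases hx : x ∈ U
    · exact hχ.contDiffAt.mul (hφ.contDiffAt (hU.mem_nhds hx))
    · refine (contDiffAt_const (c := (0 : ℝ))).congr_of_eventuallyEq ?_
      filter_upwards [hL.isClosed.isOpen_compl.mem_nhds fun h => hx (hLU h)] with y hy
      exact hsupp y hy
  · have : χ x = 1 := hW1 hx.1
    simp [this]

/-- if `K ⊂ ℂⁿ` is compact and convex with respect to principal hypersurfaces,
`U ⊇ K` is open, and `φ` is smooth strictly plurisubharmonic on `U`, then there exists a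
global smooth strictly plurisubharmonic `ψ` such that `ψ - φ` is pluriharmonic on some open
neighborhood of `K` contained in `U`. -/
theorem stmt7 (n : ℕ) (hn : 1 ≤ n) (K : Set (EuclideanSpace ℂ (Fin n)))
    (hKc : IsCompact K) (hK : PrincipalConvex K)
    (U : Set (EuclideanSpace ℂ (Fin n))) (hU : IsOpen U) (hKU : K ⊆ U)
    (φ : EuclideanSpace ℂ (Fin n) → ℝ) (hφ : ContDiffOn ℝ (⊤ : ℕ∞) φ U)
    (hφspsh : ∀ x ∈ U, ∀ w : EuclideanSpace ℂ (Fin n), w ≠ 0 → 0 < leviForm φ x w) :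
    ∃ ψ : EuclideanSpace ℂ (Fin n) → ℝ, ContDiff ℝ (⊤ : ℕ∞) ψ ∧
      (∀ x : EuclideanSpace ℂ (Fin n), ∀ w : EuclideanSpace ℂ (Fin n), w ≠ 0 →
        0 < leviForm ψ x w) ∧
      ∃ N : Set (EuclideanSpace ℂ (Fin n)), IsOpen N ∧ K ⊆ N ∧ N ⊆ U ∧
        ∀ x ∈ N, ∀ w : EuclideanSpace ℂ (Fin n),
          leviForm (fun z => ψ z - φ z) x w = 0 := by
  obtain ⟨θ, V, hθ, hθc, hV, hKV, hVU, hθφ⟩ := exists_cutoff_mul_contDiff hKc hU hKU hφ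
  obtain ⟨R, hR, hKR⟩ := (hKc.union hθc).isBounded.subset_ball_lt 0 0
  obtain ⟨e, he, he_pos⟩ := exists_isPshFlatNear_pos_off_closedBall hR.le
    (Set.subset_union_left.trans hKR)
  obtain ⟨u, hu, hu_pos⟩ := exists_isPshFlatNear_add_pos hKc hK hθ
    (S := (Metric.closedBall 0 R \ V) ×ˢ Metric.sphere 0 1)
    (((isCompact_closedBall 0 R).diff hV).prod (isCompact_sphere 0 1))
    (fun p hp => ⟨fun h => hp.1.2 (hKV h), ne_zero_of_mem_unit_sphere ⟨p.2, hp.2⟩⟩)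
  have hue := hu.add he
  have hθφ_near : ∀ x ∈ V, θ =ᶠ[nhds x] φ := fun x hx => hθφ.eventuallyEq_of_mem (hV.mem_nhds hx)
  obtain ⟨W, hW, hKW, hW0⟩ := mem_nhdsSet_iff_exists.1 hue.leviForm_eq_zero
  refine ⟨fun z => θ z + (u z + e z), hθ.add hue.contDiff, fun x w hw => ?_, W ∩ V,
    hW.inter hV, Set.subset_inter hKW hKV, Set.inter_subset_right.trans hVU, fun x hx w => ?_⟩
  · rw [leviForm_add hθ hue.contDiff]
    by_cases hxV : x ∈ V
    · rw [leviForm_congr_of_eventuallyEq (hθφ_near x hxV)]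
      exact add_pos_of_pos_of_nonneg (hφspsh x (hVU hxV) w hw) (hue.leviForm_nonneg x w)
    rw [leviForm_add hu.contDiff he.contDiff]
    rcases le_or_gt ‖x‖ R with hxR | hxR
    · have hw' : w = ‖w‖ • (‖w‖⁻¹ • w) := by
        rw [smul_smul, mul_inv_cancel₀ (norm_ne_zero_iff.2 hw), one_smul]
      have h := hu_pos (x, ‖w‖⁻¹ • w) ⟨⟨by simpa using hxR, hxV⟩, by
        simp [norm_smul, hw]⟩
      have h' := mul_pos (pow_pos (norm_pos_iff.2 hw) 2) h
      rw [mul_add, ← leviForm_real_smul, ← leviForm_real_smul, ← hw'] at h'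
      linarith [he.leviForm_nonneg x w]
    · have h0 : θ =ᶠ[nhds x] fun _ => 0 := notMem_tsupport_iff_eventuallyEq.1 fun h => by
        have := hKR (Or.inr h)
        rw [mem_ball_zero_iff] at this
        exact this.not_gt hxR
      rw [leviForm_congr_of_eventuallyEq h0, leviForm_zero, zero_add]
      exact add_pos_of_nonneg_of_pos (hu.leviForm_nonneg x w) (he_pos x w hxR hw)
  · rw [← hW0 hx.1 w]
    refine leviForm_congr_of_eventuallyEq ?_ w
    filter_upwards [hθφ_near x hx.2] with z hz
    rw [hz]
    ring
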